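/- arXiv:2411.16564 — 3 statements merged into one kernel-verified Lean document; each statement's English description precedes it below -/
import Mathlib

section
/- Let M = (S, Act, P) be an MDP and rew : S → [0,∞] a reward function for M. The least fixed point of the min-Bellman operator of M with respect to rew equals the minimal (total) expected reward: lfp Φ_min = λ s. MinER(rew, s). -/
open scoped ENNReal

noncomputable section

/-- A Markov decision process: countable state space `S`, finite action set `A`,
transition probability function `P` (values in `[0,1]`, represented in `ℝ≥0∞`)
such that each `P s a ·` is a finitely supported full or null distribution,
and every state has at least one enabled action. -/
structure MDP where
  S : Type
  A : Type
  countableS : Countable S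
  finiteA : Finite A
  P : S → A → S → ℝ≥0∞
  P_le_one : ∀ s a s', P s a s' ≤ 1
  finite_supp : ∀ s a, {s' | 0 < P s a s'}.Finite
  full_or_null : ∀ s a, (∑' s', P s a s') = 1 ∨ (∑' s', P s a s') = 0
  exists_enabled : ∀ s, ∃ a, (∑' s', P s a s') = 1

/-- Reward of a path: sum of the rewards of all its states. -/
def rewPath {σ : Type*} (rew : σ → ℝ≥0∞) (π : List σ) : ℝ≥0∞ := (π.map rew).sum

/-- Reward of the last state of a path (zero for the empty sequence). -/
def lastRew {σ : Type*} (rew : σ → ℝ≥0∞) (π : List σ) : ℝ≥0∞ := π.getLast?.elim 0 rew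

/-- Knaster–Tarski least fixed point of an endomap on a complete lattice. -/
def lfpOf {α : Type*} [CompleteLattice α] (Φ : α → α) : α := sInf {v | Φ v ≤ v}

namespace MDP

/-- The set of actions enabled in state `s`. -/
def Act (M : MDP) (s : M.S) : Set M.A := {a | (∑' s', M.P s a s') = 1}

/-- A scheduler assigns to every history (coded as the list of previously visited
states together with the current state; `𝔖 h s` is the choice for history `h ++ [s]`)
an action enabled in the current state. -/
def IsSched (M : MDP) (𝔖 : List M.S → M.S → M.A) : Prop :=
  ∀ (h : List M.S) (s : M.S), 𝔖 h s ∈ M.Act s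

/-- A scheduler is memoryless if its choice depends only on the last state. -/
def Memoryless (M : MDP) (𝔖 : List M.S → M.S → M.A) : Prop :=
  ∀ (h₁ h₂ : List M.S) (s : M.S), 𝔖 h₁ s = 𝔖 h₂ s

/-- The type of schedulers of `M`. -/
def Scheds (M : MDP) : Type := {𝔖 : List M.S → M.S → M.A // M.IsSched 𝔖}

/-- A path is a finite nonempty sequence of states such that each step is
possible via some enabled action. -/
def IsPath (M : MDP) : List M.S → Prop
  | [] => False
  | [_] => True
  | s :: s' :: rest => (∃ a ∈ M.Act s, 0 < M.P s a s') ∧ IsPath M (s' :: rest)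

/-- Probability of traversing the given remaining path, where `pref` is the
history of previously visited states. -/
def probAux (M : MDP) (𝔖 : List M.S → M.S → M.A) : List M.S → List M.S → ℝ≥0∞
  | _, [] => 1
  | _, [_] => 1
  | pref, s :: s' :: rest =>
      M.P s (𝔖 pref s) s' * probAux M 𝔖 (pref ++ [s]) (s' :: rest)

/-- The probability of a path under scheduler `𝔖` (the empty product is `1`). -/
def pathProb (M : MDP) (𝔖 : List M.S → M.S → M.A) (π : List M.S) : ℝ≥0∞ :=
  M.probAux 𝔖 [] π

/-- Paths of length exactly `n` (that is, `n` steps and `n + 1` states) starting in `s`. -/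
def PathsEq (M : MDP) (n : ℕ) (s : M.S) : Set (List M.S) :=
  {π | M.IsPath π ∧ π.head? = some s ∧ π.length = n + 1}

/-- Paths of length at most `n` starting in `s`. -/
def PathsLe (M : MDP) (n : ℕ) (s : M.S) : Set (List M.S) :=
  {π | M.IsPath π ∧ π.head? = some s ∧ π.length ≤ n + 1}

/-- All finite paths starting in `s`. -/
def Paths (M : MDP) (s : M.S) : Set (List M.S) :=
  {π | M.IsPath π ∧ π.head? = some s}

/-- Expected reward from `s` after exactly `n` steps under scheduler `𝔖`. -/
def ERn (M : MDP) (rew : M.S → ℝ≥0∞) (𝔖 : List M.S → M.S → M.A) (n : ℕ) (s : M.S) :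
    ℝ≥0∞ :=
  ∑' π : M.PathsEq n s, M.pathProb 𝔖 (π : List M.S) * rewPath rew (π : List M.S)

/-- Total expected reward from `s` under scheduler `𝔖`. -/
def ER (M : MDP) (rew : M.S → ℝ≥0∞) (𝔖 : List M.S → M.S → M.A) (s : M.S) : ℝ≥0∞ :=
  ⨆ n : ℕ, M.ERn rew 𝔖 n s

/-- Minimal expected reward from `s` after exactly `n` steps. -/
def MinERn (M : MDP) (rew : M.S → ℝ≥0∞) (n : ℕ) (s : M.S) : ℝ≥0∞ :=
  ⨅ 𝔖 : M.Scheds, M.ERn rew 𝔖.1 n s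

/-- Maximal expected reward from `s` after exactly `n` steps. -/
def MaxERn (M : MDP) (rew : M.S → ℝ≥0∞) (n : ℕ) (s : M.S) : ℝ≥0∞ :=
  ⨆ 𝔖 : M.Scheds, M.ERn rew 𝔖.1 n s

/-- Minimal (total) expected reward from `s`. -/
def MinER (M : MDP) (rew : M.S → ℝ≥0∞) (s : M.S) : ℝ≥0∞ :=
  ⨅ 𝔖 : M.Scheds, M.ER rew 𝔖.1 s

/-- Maximal (total) expected reward from `s`. -/
def MaxER (M : MDP) (rew : M.S → ℝ≥0∞) (s : M.S) : ℝ≥0∞ :=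
  ⨆ 𝔖 : M.Scheds, M.ER rew 𝔖.1 s

/-- The min-Bellman operator of `M` with respect to `rew`. -/
def bellmanMin (M : MDP) (rew : M.S → ℝ≥0∞) (v : M.S → ℝ≥0∞) : M.S → ℝ≥0∞ :=
  fun s => rew s + ⨅ a : M.Act s, ∑' s', M.P s a.1 s' * v s'

/-- The max-Bellman operator of `M` with respect to `rew`. -/
def bellmanMax (M : MDP) (rew : M.S → ℝ≥0∞) (v : M.S → ℝ≥0∞) : M.S → ℝ≥0∞ :=
  fun s => rew s + ⨆ a : M.Act s, ∑' s', M.P s a.1 s' * v s'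

end MDP

namespace MDP

/-- The scheduler that behaves like `𝔖` after `s` has been visited first. -/
def shiftSched (M : MDP) (s : M.S) (𝔖 : List M.S → M.S → M.A) : List M.S → M.S → M.A :=
  fun h t => 𝔖 (s :: h) t

lemma IsSched.shiftSched {M : MDP} {𝔖 : List M.S → M.S → M.A} (h𝔖 : M.IsSched 𝔖) (s : M.S) :
    M.IsSched (M.shiftSched s 𝔖) :=
  fun h t => h𝔖 (s :: h) t

lemma probAux_cons (M : MDP) (𝔖 : List M.S → M.S → M.A) (s : M.S) (pref π : List M.S) :
    M.probAux 𝔖 (s :: pref) π = M.probAux (M.shiftSched s 𝔖) pref π := by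
  induction π generalizing pref with
  | nil => simp [probAux]
  | cons t r ih =>
    cases r with
    | nil => simp [probAux]
    | cons t' r => simp only [probAux, List.cons_append, ih, MDP.shiftSched]

lemma exists_cons_of_mem_PathsEq {M : MDP} {n : ℕ} {s : M.S} {π : List M.S}
    (h : π ∈ M.PathsEq n s) : ∃ r, π = s :: r := by
  obtain ⟨-, h, -⟩ := h
  cases π with
  | nil => simp at h
  | cons t r => exact ⟨r, by simp_all⟩

lemma PathsEq_zero (M : MDP) (s : M.S) : M.PathsEq 0 s = {[s]} := by
  ext π
  constructor
  · intro h
    obtain ⟨r, rfl⟩ := exists_cons_of_mem_PathsEq h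
    have := h.2.2
    simp_all
  · rintro rfl
    simp [PathsEq, IsPath]

lemma pathProb_cons {M : MDP} (𝔖 : List M.S → M.S → M.A) (s : M.S) {n : ℕ} {s' : M.S}
    {π : List M.S} (h : π ∈ M.PathsEq n s') :
    M.pathProb 𝔖 (s :: π) = M.P s (𝔖 [] s) s' * M.pathProb (M.shiftSched s 𝔖) π := by
  obtain ⟨r, rfl⟩ := exists_cons_of_mem_PathsEq h
  simp [pathProb, probAux, probAux_cons]

lemma tsum_PathsEq_succ (M : MDP) (n : ℕ) (s : M.S) (F : List M.S → ℝ≥0∞)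
    (hF : ∀ s' r, F (s :: s' :: r) ≠ 0 → ∃ a ∈ M.Act s, 0 < M.P s a s') :
    ∑' π : M.PathsEq (n + 1) s, F π = ∑' s', ∑' π : M.PathsEq n s', F (s :: π) := by
  rw [← ENNReal.tsum_sigma' (fun x : Σ s', M.PathsEq n s' => F (s :: x.2))]
  have hmem : ∀ x : Σ s', M.PathsEq n s', F (s :: x.2) ≠ 0 →
      s :: (x.2 : List M.S) ∈ M.PathsEq (n + 1) s := by
    rintro ⟨s', π, hπ⟩ hne
    obtain ⟨r, rfl⟩ := exists_cons_of_mem_PathsEq hπ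
    exact ⟨⟨hF _ _ hne, hπ.1⟩, rfl, by simpa using hπ.2.2⟩
  refine tsum_eq_tsum_of_ne_zero_bij
    (fun x => ⟨s :: (x.1.2 : List M.S), hmem x.1 x.2⟩) ?_ ?_ ?_
  · rintro ⟨⟨s₁, π₁, h₁⟩, _⟩ ⟨⟨s₂, π₂, h₂⟩, _⟩ h
    have h : π₁ = π₂ := by simpa using h
    subst h
    have : s₁ = s₂ := by simpa using h₁.2.1.symm.trans h₂.2.1
    subst this
    rfl
  · rintro ⟨π, hπ⟩ hne
    obtain ⟨r, rfl⟩ := exists_cons_of_mem_PathsEq hπ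
    cases r with
    | nil => simpa using hπ.2.2
    | cons s' r =>
      exact ⟨⟨⟨s', s' :: r, hπ.1.2, rfl, by simpa using hπ.2.2⟩, hne⟩, rfl⟩
  · intro x
    rfl

lemma IsSched.exists_pos_of_pathProb_ne_zero {M : MDP} {𝔖 : List M.S → M.S → M.A}
    (h𝔖 : M.IsSched 𝔖) {s s' : M.S} {r : List M.S} (h : M.pathProb 𝔖 (s :: s' :: r) ≠ 0) :
    ∃ a ∈ M.Act s, 0 < M.P s a s' :=
  ⟨𝔖 [] s, h𝔖 [] s, pos_iff_ne_zero.2 (left_ne_zero_of_mul h)⟩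

lemma tsum_pathProb {M : MDP} {𝔖 : List M.S → M.S → M.A} (h𝔖 : M.IsSched 𝔖) (n : ℕ)
    (s : M.S) : ∑' π : M.PathsEq n s, M.pathProb 𝔖 π = 1 := by
  induction n generalizing 𝔖 s with
  | zero =>
    rw [PathsEq_zero, tsum_singleton]
    simp [pathProb, probAux]
  | succ n ih =>
    rw [tsum_PathsEq_succ M n s _ fun s' r h => h𝔖.exists_pos_of_pathProb_ne_zero h]
    calc ∑' s', ∑' π : M.PathsEq n s', M.pathProb 𝔖 (s :: π)
        = ∑' s', M.P s (𝔖 [] s) s' := by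
          refine tsum_congr fun s' => ?_
          rw [tsum_congr fun π : M.PathsEq n s' => pathProb_cons 𝔖 s π.2, ENNReal.tsum_mul_left,
            ih (h𝔖.shiftSched s), mul_one]
      _ = 1 := h𝔖 [] s

lemma ERn_zero (M : MDP) (rew : M.S → ℝ≥0∞) (𝔖 : List M.S → M.S → M.A) (s : M.S) :
    M.ERn rew 𝔖 0 s = rew s := by
  rw [ERn, PathsEq_zero, tsum_singleton [s] fun π => M.pathProb 𝔖 π * rewPath rew π]
  simp [pathProb, probAux, rewPath]

lemma ERn_succ {M : MDP} (rew : M.S → ℝ≥0∞) {𝔖 : List M.S → M.S → M.A} (h𝔖 : M.IsSched 𝔖)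
    (n : ℕ) (s : M.S) :
    M.ERn rew 𝔖 (n + 1) s =
      rew s + ∑' s', M.P s (𝔖 [] s) s' * M.ERn rew (M.shiftSched s 𝔖) n s' := by
  have hsum : ∑' s', M.P s (𝔖 [] s) s' = 1 := h𝔖 [] s
  rw [ERn, tsum_PathsEq_succ M n s (fun π => M.pathProb 𝔖 π * rewPath rew π)
    fun s' r h => h𝔖.exists_pos_of_pathProb_ne_zero (left_ne_zero_of_mul h)]
  calc ∑' s', ∑' π : M.PathsEq n s', M.pathProb 𝔖 (s :: π) * rewPath rew (s :: π)
      = ∑' s', (M.P s (𝔖 [] s) s' * rew s +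
          M.P s (𝔖 [] s) s' * M.ERn rew (M.shiftSched s 𝔖) n s') := by
        refine tsum_congr fun s' => ?_
        have hπ : ∀ π : M.PathsEq n s', M.pathProb 𝔖 (s :: π) * rewPath rew (s :: π) =
            M.P s (𝔖 [] s) s' * (M.pathProb (M.shiftSched s 𝔖) π * rew s +
              M.pathProb (M.shiftSched s 𝔖) π * rewPath rew π) := by
          intro π
          rw [pathProb_cons 𝔖 s π.2, mul_assoc, ← mul_add]
          simp [rewPath]
        rw [tsum_congr hπ, ENNReal.tsum_mul_left, ENNReal.tsum_add, ENNReal.tsum_mul_right,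
          tsum_pathProb (h𝔖.shiftSched s), one_mul, mul_add, ERn]
    _ = _ := by rw [ENNReal.tsum_add, ENNReal.tsum_mul_right, hsum, one_mul]

lemma monotone_ERn {M : MDP} (rew : M.S → ℝ≥0∞) {𝔖 : List M.S → M.S → M.A}
    (h𝔖 : M.IsSched 𝔖) (s : M.S) : Monotone fun n => M.ERn rew 𝔖 n s := by
  refine monotone_nat_of_le_succ fun n => ?_
  induction n generalizing 𝔖 s with
  | zero => rw [ERn_zero, ERn_succ rew h𝔖]; exact le_self_add
  | succ n ih =>
    rw [ERn_succ rew h𝔖, ERn_succ rew h𝔖]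
    gcongr with s'
    exact ih (h𝔖.shiftSched s) s'

lemma tsum_P_mul_iSup (M : MDP) (s : M.S) (a : M.A) (f : ℕ → M.S → ℝ≥0∞)
    (hf : ∀ s', Monotone fun n => f n s') :
    ∑' s', M.P s a s' * ⨆ n, f n s' = ⨆ n, ∑' s', M.P s a s' * f n s' := by
  have hfin (v : M.S → ℝ≥0∞) : ∑' s', M.P s a s' * v s' =
      ∑ s' ∈ (M.finite_supp s a).toFinset, M.P s a s' * v s' := by
    refine tsum_eq_sum fun s' hs' => ?_
    have : M.P s a s' = 0 := by simpa using hs'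
    rw [this, zero_mul]
  simp_rw [hfin, ENNReal.mul_iSup]
  exact ENNReal.finsetSum_iSup_of_monotone fun s' m n hmn => mul_le_mul_right (hf s' hmn) _

lemma ER_eq {M : MDP} (rew : M.S → ℝ≥0∞) {𝔖 : List M.S → M.S → M.A} (h𝔖 : M.IsSched 𝔖)
    (s : M.S) :
    M.ER rew 𝔖 s = rew s + ∑' s', M.P s (𝔖 [] s) s' * M.ER rew (M.shiftSched s 𝔖) s' := by
  have hER : M.ER rew 𝔖 s = ⨆ n, M.ERn rew 𝔖 (n + 1) s :=
    ((monotone_ERn rew h𝔖 s).iSup_nat_add 1).symm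
  simp_rw [hER, ERn_succ rew h𝔖, ← ENNReal.add_iSup]
  rw [← tsum_P_mul_iSup M s _ _ fun s' => monotone_ERn rew (h𝔖.shiftSched s) s']
  rfl

lemma monotone_bellmanMin (M : MDP) (rew : M.S → ℝ≥0∞) : Monotone (M.bellmanMin rew) := by
  intro v w hvw s
  unfold bellmanMin
  gcongr with a s'
  exact hvw s'

lemma bellmanMin_MinER_le (M : MDP) (rew : M.S → ℝ≥0∞) :
    M.bellmanMin rew (M.MinER rew) ≤ M.MinER rew := by
  intro s
  refine le_iInf fun 𝔖 => ?_
  rw [ER_eq rew 𝔖.2]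
  refine add_le_add le_rfl ((iInf_le _ ⟨𝔖.1 [] s, 𝔖.2 [] s⟩).trans ?_)
  gcongr with s'
  exact iInf_le _ (⟨_, IsSched.shiftSched 𝔖.2 s⟩ : M.Scheds)

lemma exists_bellmanMin_eq (M : MDP) (rew v : M.S → ℝ≥0∞) (s : M.S) :
    ∃ a ∈ M.Act s, M.bellmanMin rew v s = rew s + ∑' s', M.P s a s' * v s' := by
  have := M.finiteA
  have : Nonempty (M.Act s) := (M.exists_enabled s).elim fun a ha => ⟨⟨a, ha⟩⟩
  obtain ⟨a, ha⟩ := exists_eq_ciInf_of_finite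
    (f := fun a : M.Act s => ∑' s', M.P s a.1 s' * v s')
  exact ⟨a, a.2, by rw [bellmanMin, ← ha]⟩

lemma MinER_le_of_bellmanMin_le (M : MDP) (rew : M.S → ℝ≥0∞) {v : M.S → ℝ≥0∞}
    (hv : M.bellmanMin rew v ≤ v) : M.MinER rew ≤ v := by
  choose act hact hopt using M.exists_bellmanMin_eq rew v
  let 𝔖 : M.Scheds := ⟨fun _ t => act t, fun _ t => hact t⟩
  intro s
  refine (iInf_le _ 𝔖).trans (iSup_le fun n => ?_)
  induction n generalizing s with
  | zero =>
    rw [ERn_zero]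
    exact le_self_add.trans (hv s)
  | succ n ih =>
    rw [ERn_succ rew 𝔖.2]
    refine le_trans ?_ ((hopt s).symm.trans_le (hv s))
    gcongr with s'
    exact ih s'

end MDP

/-- The minimal total expected reward `fun s => MinER(rew, s)` is the
least fixed point of the min-Bellman operator of `M` with respect to `rew`, i.e.
`lfp Φmin = fun s => MinER(rew, s)`. -/
theorem lfp_bellmanMin_eq_MinER (M : MDP) (rew : M.S → ℝ≥0∞) :
    IsLeast {w | M.bellmanMin rew w = w} (fun s => M.MinER rew s) := by
  have hle := M.bellmanMin_MinER_le rew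
  refine ⟨le_antisymm hle ?_, fun w hw => M.MinER_le_of_bellmanMin_le rew (le_of_eq hw)⟩
  exact M.MinER_le_of_bellmanMin_le rew (M.monotone_bellmanMin rew hle)
end
end

section
/- Let M = (S, Act, P) be an MDP and rew : S → [0,∞] a reward function for M. The least fixed point of the max-Bellman operator of M with respect to rew equals the maximal (total) expected reward: lfp Φ_max = λ s. MaxER(rew, s). -/
open scoped ENNReal

noncomputable section

namespace MDP

variable (M : MDP) (rew : M.S → ℝ≥0∞)

/-- Prepending `s` to a path of length `n` from a successor of `s` yields exactly the paths of
length `n + 1` from `s`. -/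
def pathsEqSuccEquiv (n : ℕ) (s : M.S) :
    (Σ s' : {s' | ∃ a ∈ M.Act s, 0 < M.P s a s'}, M.PathsEq n s') ≃ M.PathsEq (n + 1) s where
  toFun x := ⟨s :: x.2.1, by
    obtain ⟨⟨s', hs'⟩, ⟨π, hp, hh, hl⟩⟩ := x
    cases π with
    | nil => simp at hh
    | cons t r =>
      obtain rfl : t = s' := by simpa using hh
      exact ⟨⟨hs', hp⟩, rfl, by simpa using hl⟩⟩
  invFun y := match y with
    | ⟨[], h⟩ => h.1.elim
    | ⟨[_], h⟩ => absurd h.2.2 (by simp)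
    | ⟨t :: t' :: r, h⟩ => ⟨⟨t', by
        obtain rfl : t = s := by simpa using h.2.1
        exact h.1.1⟩, ⟨t' :: r, h.1.2, rfl, by simpa using h.2.2⟩⟩
  left_inv x := by
    obtain ⟨⟨s', hs'⟩, ⟨π, hp, hh, hl⟩⟩ := x
    cases π with
    | nil => simp at hh
    | cons t r =>
      obtain rfl : t = s' := by simpa using hh
      rfl
  right_inv y := by
    obtain ⟨π, hp, hh, hl⟩ := y
    match π, hp, hh, hl with
    | [_], _, _, hl => simp at hl
    | t :: t' :: r, hp, hh, hl =>
      obtain rfl : t = s := by simpa using hh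
      rfl

variable {M} {𝔖 : List M.S → M.S → M.A}

theorem tsum_pathsEq_zero (f : List M.S → ℝ≥0∞) (s : M.S) :
    ∑' π : M.PathsEq 0 s, f π = f [s] := by
  have h : M.PathsEq 0 s = {[s]} := by
    ext π
    match π with
    | [] => simp [PathsEq]
    | [t] => simp [PathsEq, IsPath]
    | t :: t' :: r => simp [PathsEq]
  rw [h]
  exact tsum_singleton [s] f

theorem tsum_pathsEq_succ (h𝔖 : M.IsSched 𝔖) (g : List M.S → ℝ≥0∞) (pref : List M.S) (n : ℕ)
    (s : M.S) :
    ∑' π : M.PathsEq (n + 1) s, M.probAux 𝔖 pref π * g π =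
      ∑' s', M.P s (𝔖 pref s) s' *
        ∑' π : M.PathsEq n s', M.probAux 𝔖 (pref ++ [s]) π * g (s :: π) := by
  rw [← (M.pathsEqSuccEquiv n s).tsum_eq, ENNReal.tsum_sigma']
  have h : ∀ (s' : {s' | ∃ a ∈ M.Act s, 0 < M.P s a s'}) (π : M.PathsEq n s'),
      M.probAux 𝔖 pref (M.pathsEqSuccEquiv n s ⟨s', π⟩) * g (M.pathsEqSuccEquiv n s ⟨s', π⟩) =
        M.P s (𝔖 pref s) s' * (M.probAux 𝔖 (pref ++ [s]) π * g (s :: π)) := by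
    rintro ⟨s', hs'⟩ ⟨π, hp, hh, hl⟩
    cases π with
    | nil => simp at hh
    | cons t r =>
      obtain rfl : t = s' := by simpa using hh
      exact mul_assoc _ _ _
  simp_rw [h, ENNReal.tsum_mul_left]
  refine tsum_subtype_eq_of_support_subset (f := fun s' => M.P s (𝔖 pref s) s' *
    ∑' π : M.PathsEq n s', M.probAux 𝔖 (pref ++ [s]) π * g (s :: π)) fun s' hs' => ?_
  exact ⟨_, h𝔖 pref s, pos_iff_ne_zero.2 (left_ne_zero_of_mul hs')⟩

theorem tsum_probAux (h𝔖 : M.IsSched 𝔖) (pref : List M.S) (n : ℕ) (s : M.S) :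
    ∑' π : M.PathsEq n s, M.probAux 𝔖 pref π = 1 := by
  induction n generalizing pref s with
  | zero => rw [tsum_pathsEq_zero (M.probAux 𝔖 pref)]; rfl
  | succ n ih =>
    have h := tsum_pathsEq_succ h𝔖 (fun _ => 1) pref n s
    simp only [mul_one, ih] at h
    exact h.trans (h𝔖 pref s)

/-- Expected reward of the next `n` steps from `s` under `𝔖` after the history `pref`. -/
def histER (rew : M.S → ℝ≥0∞) (𝔖 : List M.S → M.S → M.A) (pref : List M.S) (n : ℕ) (s : M.S) :
    ℝ≥0∞ :=
  ∑' π : M.PathsEq n s, M.probAux 𝔖 pref π * rewPath rew π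

theorem histER_zero (pref : List M.S) (s : M.S) : histER rew 𝔖 pref 0 s = rew s := by
  rw [histER, tsum_pathsEq_zero fun π => M.probAux 𝔖 pref π * rewPath rew π]
  simp [probAux, rewPath]

theorem histER_succ (h𝔖 : M.IsSched 𝔖) (pref : List M.S) (n : ℕ) (s : M.S) :
    histER rew 𝔖 pref (n + 1) s =
      rew s + ∑' s', M.P s (𝔖 pref s) s' * histER rew 𝔖 (pref ++ [s]) n s' := by
  have h : ∀ π, rewPath rew (s :: π) = rew s + rewPath rew π := fun _ => rfl
  have hone : ∑' s', M.P s (𝔖 pref s) s' = 1 := h𝔖 pref s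
  simp_rw [histER, tsum_pathsEq_succ h𝔖, h, mul_add, ENNReal.tsum_add, ENNReal.tsum_mul_right,
    tsum_probAux h𝔖, one_mul, mul_add, ENNReal.tsum_add, ENNReal.tsum_mul_right, hone, one_mul]

theorem bellmanMax_mono : Monotone (M.bellmanMax rew) := fun v w h s => by
  unfold bellmanMax
  gcongr
  exact h _

theorem iterate_bellmanMax_mono : Monotone fun n => (M.bellmanMax rew)^[n] ⊥ :=
  (bellmanMax_mono rew).monotone_iterate_of_le_map bot_le

theorem bellmanMax_bot : M.bellmanMax rew ⊥ = rew := by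
  ext s
  simp [bellmanMax]

theorem histER_le_iterate (h𝔖 : M.IsSched 𝔖) (pref : List M.S) (n : ℕ) (s : M.S) :
    histER rew 𝔖 pref n s ≤ (M.bellmanMax rew)^[n + 1] ⊥ s := by
  induction n generalizing pref s with
  | zero => rw [histER_zero]; simp [bellmanMax_bot]
  | succ n ih =>
    rw [histER_succ rew h𝔖, Function.iterate_succ_apply']
    refine add_le_add le_rfl (le_iSup_of_le ⟨𝔖 pref s, h𝔖 pref s⟩ ?_)
    gcongr
    exact ih _ _

theorem exists_bellmanMax_eq (v : M.S → ℝ≥0∞) (s : M.S) :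
    ∃ a ∈ M.Act s, M.bellmanMax rew v s = rew s + ∑' s', M.P s a s' * v s' := by
  have := M.finiteA
  have : Nonempty (M.Act s) := (M.exists_enabled s).elim fun a ha => ⟨⟨a, ha⟩⟩
  obtain ⟨a, ha⟩ := exists_eq_ciSup_of_finite (f := fun a : M.Act s => ∑' s', M.P s a.1 s' * v s')
  exact ⟨a, a.2, by rw [bellmanMax, ← ha]⟩

theorem exists_sched_histER_eq_iterate (n : ℕ) :
    ∃ 𝔖 : List M.S → M.S → M.A, M.IsSched 𝔖 ∧
      ∀ s, histER rew 𝔖 [] n s = (M.bellmanMax rew)^[n + 1] ⊥ s := by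
  choose act hact heq using exists_bellmanMax_eq (M := M) rew
  let 𝔖 : List M.S → M.S → M.A := fun h => act ((M.bellmanMax rew)^[n - h.length] ⊥)
  have h𝔖 : M.IsSched 𝔖 := fun _ _ => hact _ _
  have key : ∀ m pref s, pref.length + m = n →
      histER rew 𝔖 pref m s = (M.bellmanMax rew)^[m + 1] ⊥ s := by
    intro m
    induction m with
    | zero => intro pref s _; rw [histER_zero]; simp [bellmanMax_bot]
    | succ m ih =>
      intro pref s h
      have hm : n - pref.length = m + 1 := by omega
      rw [histER_succ rew h𝔖, Function.iterate_succ_apply', heq]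
      simp_rw [ih (pref ++ [s]) _ (by simp; omega), 𝔖, hm]
  exact ⟨𝔖, h𝔖, fun s => key n [] s (by simp)⟩

theorem MaxER_eq_iSup_iterate (s : M.S) :
    M.MaxER rew s = ⨆ n, (M.bellmanMax rew)^[n] ⊥ s := by
  refine le_antisymm (iSup_le fun 𝔖 => iSup_le fun n => ?_) (iSup_le fun n => ?_)
  · exact (histER_le_iterate rew 𝔖.2 [] n s).trans
      (le_iSup (fun n => (M.bellmanMax rew)^[n] ⊥ s) (n + 1))
  · obtain ⟨𝔖, h𝔖, h⟩ := exists_sched_histER_eq_iterate (M := M) rew n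
    calc (M.bellmanMax rew)^[n] ⊥ s ≤ (M.bellmanMax rew)^[n + 1] ⊥ s :=
          iterate_bellmanMax_mono rew n.le_succ s
      _ = M.ERn rew 𝔖 n s := (h s).symm
      _ ≤ M.MaxER rew s := le_iSup_of_le ⟨𝔖, h𝔖⟩ (le_iSup (fun n => M.ERn rew 𝔖 n s) n)

theorem bellmanMax_iSup {v : ℕ → M.S → ℝ≥0∞} (hv : Monotone v) (s : M.S) :
    M.bellmanMax rew (fun s => ⨆ n, v n s) s = ⨆ n, M.bellmanMax rew (v n) s := by
  have h : ∀ a, ∑' s', M.P s a s' * ⨆ n, v n s' = ⨆ n, ∑' s', M.P s a s' * v n s' := by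
    intro a
    simp_rw [ENNReal.mul_iSup, ENNReal.tsum_eq_iSup_sum]
    rw [iSup_comm]
    refine iSup_congr fun F => ENNReal.finsetSum_iSup_of_monotone fun s' i j hij => ?_
    gcongr
    exact hv hij s'
  simp_rw [bellmanMax, h]
  rw [iSup_comm, ENNReal.add_iSup]

end MDP

/-- The maximal total expected reward `fun s => MaxER(rew, s)` is the
least fixed point of the max-Bellman operator of `M` with respect to `rew`, i.e.
`lfp Φmax = fun s => MaxER(rew, s)`. -/
theorem lfp_bellmanMax_eq_MaxER (M : MDP) (rew : M.S → ℝ≥0∞) :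
    IsLeast {w | M.bellmanMax rew w = w} (fun s => M.MaxER rew s) := by
  have h : (fun s => M.MaxER rew s) = fun s => ⨆ n, (M.bellmanMax rew)^[n] ⊥ s :=
    funext (MDP.MaxER_eq_iSup_iterate rew)
  rw [h]
  refine ⟨funext fun s => ?_, fun w hw s => iSup_le fun n => ?_⟩
  · have hmono := MDP.iterate_bellmanMax_mono (M := M) rew
    rw [MDP.bellmanMax_iSup rew hmono]
    simp_rw [← Function.iterate_succ_apply' (M.bellmanMax rew)]
    exact Monotone.iSup_nat_add (f := fun n => (M.bellmanMax rew)^[n] ⊥ s)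
      (fun i j hij => hmono hij s) 1
  · have hw' : (M.bellmanMax rew)^[n] w = w := Function.iterate_fixed hw n
    rw [← hw']
    exact (MDP.bellmanMax_mono rew).iterate n bot_le s
end
end

section
/- Let M = (S, Act, P) be an MDP, rew : S → [0,∞] a reward function for M, and 𝔖 a scheduler. For every state s ∈ S, the total expected reward under 𝔖 equals the countable sum, over all finite paths starting in s, of the path probability times the reward of the last state: ER_𝔖(rew, s) = ∑_{s_0…s_m ∈ Paths(s)} P^𝔖(s_0…s_m)·rew(s_m). -/
open scoped ENNReal

noncomputable section

namespace MDP

/-- Expected value of `f` over the paths with `n` steps starting in `s`, given the history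
`pref`, for the path measure induced by the scheduler `𝔖`. -/
def pathExp (M : MDP) (𝔖 : List M.S → M.S → M.A) (pref : List M.S) (n : ℕ) (s : M.S)
    (f : List M.S → ℝ≥0∞) : ℝ≥0∞ :=
  ∑' π : M.PathsEq n s, M.probAux 𝔖 pref (π : List M.S) * f (π : List M.S)

variable (M : MDP) (rew : M.S → ℝ≥0∞) (𝔖 : List M.S → M.S → M.A) (pref : List M.S)

lemma pathExp_congr {n : ℕ} {s : M.S} {f g : List M.S → ℝ≥0∞}
    (h : ∀ π ∈ M.PathsEq n s, f π = g π) :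
    M.pathExp 𝔖 pref n s f = M.pathExp 𝔖 pref n s g :=
  tsum_congr fun π => by rw [h π π.2]

lemma pathExp_add (n : ℕ) (s : M.S) (f g : List M.S → ℝ≥0∞) :
    M.pathExp 𝔖 pref n s (fun π => f π + g π) =
      M.pathExp 𝔖 pref n s f + M.pathExp 𝔖 pref n s g := by
  simp only [pathExp, mul_add, ENNReal.tsum_add]

lemma pathExp_const (n : ℕ) (s : M.S) (c : ℝ≥0∞) :
    M.pathExp 𝔖 pref n s (fun _ => c) = M.pathExp 𝔖 pref n s (fun _ => 1) * c := by
  simp only [pathExp, mul_one, ENNReal.tsum_mul_right]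

lemma pathsEq_zero (s : M.S) : M.PathsEq 0 s = {[s]} := by
  ext π
  rcases π with _ | ⟨t, _ | ⟨u, r⟩⟩ <;> simp [PathsEq, IsPath]

lemma pathExp_zero (s : M.S) (f : List M.S → ℝ≥0∞) :
    M.pathExp 𝔖 pref 0 s f = f [s] := by
  rw [pathExp, pathsEq_zero, tsum_singleton ([s] : List M.S) fun π => M.probAux 𝔖 pref π * f π]
  simp [probAux]

variable {𝔖}

lemma indicator_pathsEq_succ_cons (h𝔖 : M.IsSched 𝔖) (n : ℕ) (s : M.S)
    (f : List M.S → ℝ≥0∞) (π : List M.S) :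
    (M.PathsEq (n + 1) s).indicator (fun π => M.probAux 𝔖 pref π * f π) (s :: π) =
      ∑' s', M.P s (𝔖 pref s) s' * (M.PathsEq n s').indicator
        (fun π => M.probAux 𝔖 (pref ++ [s]) π * f (s :: π)) π := by
  classical
  rcases π with _ | ⟨t, r⟩
  · simp [PathsEq, IsPath, Set.indicator]
  · rw [tsum_eq_single t]
    · by_cases hP : M.P s (𝔖 pref s) t = 0
      · simp [Set.indicator, probAux, hP]
      · have hstep : ∃ a ∈ M.Act s, 0 < M.P s a t :=
          ⟨_, h𝔖 pref s, pos_iff_ne_zero.mpr hP⟩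
        have hmem : s :: t :: r ∈ M.PathsEq (n + 1) s ↔ t :: r ∈ M.PathsEq n t := by
          simp [PathsEq, IsPath, hstep]
        simp [Set.indicator, hmem, probAux, mul_assoc]
    · intro t' ht'
      simp [PathsEq, Set.indicator, Ne.symm ht']

lemma pathExp_succ (h𝔖 : M.IsSched 𝔖) (n : ℕ) (s : M.S) (f : List M.S → ℝ≥0∞) :
    M.pathExp 𝔖 pref (n + 1) s f =
      ∑' s', M.P s (𝔖 pref s) s' *
        M.pathExp 𝔖 (pref ++ [s]) n s' (fun π => f (s :: π)) := by
  have hsupp : Function.support ((M.PathsEq (n + 1) s).indicator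
      fun π => M.probAux 𝔖 pref π * f π) ⊆ Set.range (List.cons s) := by
    intro π hπ
    have hmem := Set.mem_of_indicator_ne_zero hπ
    rcases π with _ | ⟨t, r⟩
    · exact hmem.1.elim
    · obtain rfl : t = s := by simpa using hmem.2.1
      exact ⟨r, rfl⟩
  rw [pathExp, tsum_subtype (M.PathsEq (n + 1) s) fun π => M.probAux 𝔖 pref π * f π,
    ← (List.cons_injective (a := s)).tsum_eq hsupp]
  simp only [M.indicator_pathsEq_succ_cons pref h𝔖 n s f]
  rw [ENNReal.tsum_comm]
  refine tsum_congr fun s' => ?_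
  rw [ENNReal.tsum_mul_left, pathExp,
    tsum_subtype (M.PathsEq n s') fun π => M.probAux 𝔖 (pref ++ [s]) π * f (s :: π)]

lemma pathExp_one (h𝔖 : M.IsSched 𝔖) (n : ℕ) (s : M.S) :
    M.pathExp 𝔖 pref n s (fun _ => 1) = 1 := by
  induction n generalizing pref s with
  | zero => rw [pathExp_zero]
  | succ n ih =>
    simp only [M.pathExp_succ pref h𝔖, ih, mul_one]
    exact h𝔖 pref s

lemma pathExp_succ_lastRew (h𝔖 : M.IsSched 𝔖) (n : ℕ) (s : M.S) :
    M.pathExp 𝔖 pref (n + 1) s (lastRew rew) =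
      ∑' s', M.P s (𝔖 pref s) s' * M.pathExp 𝔖 (pref ++ [s]) n s' (lastRew rew) := by
  rw [M.pathExp_succ pref h𝔖]
  refine tsum_congr fun s' => congrArg _ (M.pathExp_congr _ _ fun π hπ => ?_)
  rcases π with _ | ⟨t, r⟩
  · exact hπ.1.elim
  · simp [lastRew, List.getLast?_cons_cons]

lemma pathExp_succ_rewPath (h𝔖 : M.IsSched 𝔖) (n : ℕ) (s : M.S) :
    M.pathExp 𝔖 pref (n + 1) s (rewPath rew) =
      rew s + ∑' s', M.P s (𝔖 pref s) s' *
        M.pathExp 𝔖 (pref ++ [s]) n s' (rewPath rew) := by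
  have hone : ∑' s', M.P s (𝔖 pref s) s' = 1 := h𝔖 pref s
  have hcons (π : List M.S) : rewPath rew (s :: π) = rew s + rewPath rew π := by
    simp [rewPath]
  simp only [M.pathExp_succ pref h𝔖, hcons]
  simp only [pathExp_add]
  simp only [M.pathExp_const _ _ _ _ (rew s), M.pathExp_one _ h𝔖,
    one_mul, mul_add, ENNReal.tsum_add, ENNReal.tsum_mul_right, hone]

/-- The expected accumulated reward of `n` steps is the sum of the expected rewards of the
states reached after `0, …, n` steps. -/
lemma pathExp_rewPath_eq_sum (h𝔖 : M.IsSched 𝔖) (n : ℕ) (s : M.S) :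
    M.pathExp 𝔖 pref n s (rewPath rew) =
      ∑ m ∈ Finset.range (n + 1), M.pathExp 𝔖 pref m s (lastRew rew) := by
  induction n generalizing pref s with
  | zero => simp [pathExp_zero, rewPath, lastRew]
  | succ n ih =>
    rw [M.pathExp_succ_rewPath rew pref h𝔖, Finset.sum_range_succ', add_comm, pathExp_zero]
    simp only [ih, M.pathExp_succ_lastRew rew pref h𝔖, Finset.mul_sum]
    rw [Summable.tsum_finsetSum fun _ _ => ENNReal.summable]
    simp [lastRew]

lemma tsum_paths_eq_tsum_pathsEq (s : M.S) (g : List M.S → ℝ≥0∞) :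
    ∑' π : M.Paths s, g π = ∑' n, ∑' π : M.PathsEq n s, g π := by
  simp only [tsum_subtype (M.Paths s) g, fun n => tsum_subtype (M.PathsEq n s) g]
  rw [ENNReal.tsum_comm]
  refine tsum_congr fun π => ?_
  classical
  rcases π with _ | ⟨t, r⟩
  · simp [Set.indicator, Paths, PathsEq, IsPath]
  · rw [tsum_eq_single r.length]
    · simp [Set.indicator, Paths, PathsEq]
    · intro n hn
      simp [Set.indicator, PathsEq, hn.symm]

end MDP

/-- For every scheduler `𝔖` and every state `s`, the total expected
reward under `𝔖` equals the countable sum, over all finite paths starting in `s`, of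
the path probability times the reward of the last state:
`ER_𝔖(rew, s) = ∑_{s₀…s_m ∈ Paths(s)} P^𝔖(s₀…s_m) · rew(s_m)`. -/
theorem ER_eq_tsum_paths_lastRew (M : MDP) (rew : M.S → ℝ≥0∞)
    (𝔖 : List M.S → M.S → M.A) (h𝔖 : M.IsSched 𝔖) (s : M.S) :
    M.ER rew 𝔖 s =
      ∑' π : M.Paths s,
        M.pathProb 𝔖 (π : List M.S) * lastRew rew (π : List M.S) := by
  have hERn (n : ℕ) : M.ERn rew 𝔖 n s =
      ∑ m ∈ Finset.range (n + 1), M.pathExp 𝔖 [] m s (lastRew rew) :=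
    M.pathExp_rewPath_eq_sum rew [] h𝔖 n s
  rw [M.tsum_paths_eq_tsum_pathsEq s fun π => M.pathProb 𝔖 π * lastRew rew π,
    ENNReal.tsum_eq_iSup_nat, MDP.ER]
  simp only [hERn]
  exact Monotone.iSup_nat_add
    (f := fun n => ∑ m ∈ Finset.range n, M.pathExp 𝔖 [] m s (lastRew rew))
    (fun _ _ h => Finset.sum_le_sum_of_subset (Finset.range_mono h)) 1
end
end
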